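/- arXiv:2603.29567 — 2 statements merged into one kernel-verified Lean document; each statement's English description precedes it below -/
import Mathlib

section
/- Fix ε > 0. Let (x_n) be a sequence of points in ℝ^d with x_n → x ∈ ℝ^d, and let (χ_n) be a sequence of admissible irrigation plans for μ with χ_n → χ for some χ ∈ IP(μ). Assume there exists a constant C > 0 such that ∫_Θ T_n(θ) dθ ≤ C for all n ≥ 1, where T_n denotes the stopping time of χ_n. Then limsup_{n→∞} W_ε(x_n, χ_n) ≤ W_ε(x, χ). -/
open MeasureTheory Filter Topology
open scoped ENNReal NNReal

noncomputable section

/-- Euclidean space `ℝ^d`. -/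
abbrev Euc (d : ℕ) : Type := EuclideanSpace ℝ (Fin d)

/-- `Θ = [0, M]` where `M = μ(ℝ^d)` is the total mass. -/
def Theta {d : ℕ} (μ : Measure (Euc d)) : Set ℝ := Set.Icc 0 (μ Set.univ).toReal

/-- The stopping time `T(θ)` of a Lagrangian path. -/
def stopTime {d : ℕ} (χ : ℝ → ℝ → Euc d) (θ : ℝ) : ℝ :=
  sInf {t : ℝ | 0 < t ∧ ∀ t' ≥ t, χ θ t' = χ θ t}

/-- An admissible irrigation plan for the measure `μ`: measurable, `1`-Lipschitz and eventually
constant paths, all starting at the origin, whose final positions push the Lebesgue measure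
on `Θ = [0,M]` forward onto `μ`. -/
structure IsIrrigPlan {d : ℕ} (μ : Measure (Euc d)) (χ : ℝ → ℝ → Euc d) : Prop where
  measurable : Measurable (Function.uncurry χ)
  lipschitz : ∀ θ ∈ Theta μ, LipschitzWith 1 (χ θ)
  eventuallyConst : ∀ θ ∈ Theta μ, ∃ t, 0 < t ∧ ∀ t' ≥ t, χ θ t' = χ θ t
  init : ∀ θ ∈ Theta μ, χ θ 0 = 0
  pushforward :
    Measure.map (fun θ => χ θ (stopTime χ θ)) (volume.restrict (Theta μ)) = μ

/-- The multiplicity `|x|_χ`: the measure of the set of particles passing through `x`. -/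
def mult {d : ℕ} (μ : Measure (Euc d)) (χ : ℝ → ℝ → Euc d) (x : Euc d) : ℝ≥0∞ :=
  volume {θ ∈ Theta μ | ∃ t, 0 ≤ t ∧ χ θ t = x}

/-- The `α`-irrigation cost `E^α(χ)`. -/
def irrCost {d : ℕ} (μ : Measure (Euc d)) (α : ℝ) (χ : ℝ → ℝ → Euc d) : ℝ≥0∞ :=
  ∫⁻ θ in Theta μ, ∫⁻ t in Set.Ici (0:ℝ),
    (mult μ χ (χ θ t)) ^ (α - 1) * (‖deriv (χ θ) t‖₊ : ℝ≥0∞)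

/-- `ρ(θ,x) = min_{t ≥ 0} |χ(θ,t) − x|`. -/
def pathInfDist {d : ℕ} (χ : ℝ → ℝ → Euc d) (θ : ℝ) (x : Euc d) : ℝ :=
  ⨅ t : Set.Ici (0:ℝ), dist (χ θ (t : ℝ)) x

/-- A mollifying kernel: a nonnegative, non-increasing, Lipschitz function on `ℝ₊`
with `J(0) = 1` and `J(r) → 0` as `r → ∞`. -/
def MollKernel (J : ℝ → ℝ) : Prop :=
  (∀ r, 0 ≤ r → 0 ≤ J r) ∧ AntitoneOn J (Set.Ici 0) ∧
    (∃ K : ℝ≥0, LipschitzOnWith K J (Set.Ici 0)) ∧ J 0 = 1 ∧ Tendsto J atTop (𝓝 0)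

/-- The mollified multiplicity `W_ε(x,χ) = ∫_Θ J_ε(min_{t≥0} |χ(θ,t) − x|) dθ`. -/
def Wmol {d : ℕ} (μ : Measure (Euc d)) (J : ℝ → ℝ) (ε : ℝ) (χ : ℝ → ℝ → Euc d)
    (x : Euc d) : ℝ≥0∞ :=
  ∫⁻ θ in Theta μ, ENNReal.ofReal (J (pathInfDist χ θ x / ε))

/-- The mollified irrigation cost `E^α_ε(χ)`. -/
def Emol {d : ℕ} (μ : Measure (Euc d)) (J : ℝ → ℝ) (α ε : ℝ)
    (χ : ℝ → ℝ → Euc d) : ℝ≥0∞ :=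
  ∫⁻ θ in Theta μ, ∫⁻ t in Set.Ici (0:ℝ),
    (Wmol μ J ε χ (χ θ t)) ^ (α - 1) * (‖deriv (χ θ) t‖₊ : ℝ≥0∞)

/-- The distance `d(γ₀,γ₁) = sup_{k ≥ 1} (1/k) ‖γ₀ − γ₁‖_{L^∞([0,k])}` between paths. -/
def dPath {d : ℕ} (γ₀ γ₁ : ℝ → Euc d) : ℝ :=
  ⨆ k : ℕ+, (1 / ((k : ℕ) : ℝ)) *
    ⨆ t : Set.Icc (0:ℝ) ((k : ℕ) : ℝ), dist (γ₀ (t : ℝ)) (γ₁ (t : ℝ))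

/-- Convergence `χ_n → χ` of irrigation plans: `d(χ_n(θ,·), χ(θ,·)) → 0` for a.e. `θ ∈ Θ`. -/
def PlansTendsto {d : ℕ} (μ : Measure (Euc d)) (χs : ℕ → ℝ → ℝ → Euc d)
    (χ : ℝ → ℝ → Euc d) : Prop :=
  ∀ᵐ θ ∂(volume.restrict (Theta μ)),
    Tendsto (fun n => dPath (χs n θ) (χ θ)) atTop (𝓝 0)

/-- The plan `χ` is parameterized by arc-length: for a.e. `t`, `|∂_t χ(θ,t)| = 1` for
`0 < t < T(θ)` and `|∂_t χ(θ,t)| = 0` for `t > T(θ)`. -/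
def ArcLength {d : ℕ} (μ : Measure (Euc d)) (χ : ℝ → ℝ → Euc d) : Prop :=
  ∀ θ ∈ Theta μ, ∀ᵐ t ∂(volume : Measure ℝ),
    (0 < t → t < stopTime χ θ → ‖deriv (χ θ) t‖ = 1) ∧
    (stopTime χ θ < t → ‖deriv (χ θ) t‖ = 0)

/-- An alternative mollifying kernel: smooth, positive, strictly decreasing on `ℝ₊`,
with `1 ≤ ∫₀^∞ J(r) dr < ∞`. -/
def MollKernel2 (J : ℝ → ℝ) : Prop :=
  ContDiffOn ℝ (⊤ : ℕ∞) J (Set.Ici 0) ∧ (∀ r, 0 ≤ r → 0 < J r) ∧ StrictAntiOn J (Set.Ici 0) ∧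
    IntegrableOn J (Set.Ioi 0) volume ∧ 1 ≤ ∫ r in Set.Ioi (0:ℝ), J r

/-- The alternative mollified multiplicity
`W̃_ε(x,χ) = ∫_Θ min{1, ∫₀^∞ (1/ε) J_ε(|χ(θ,t) − x|) |∂_t χ(θ,t)| dt} dθ`. -/
def Wtil {d : ℕ} (μ : Measure (Euc d)) (J : ℝ → ℝ) (ε : ℝ) (χ : ℝ → ℝ → Euc d)
    (x : Euc d) : ℝ≥0∞ :=
  ∫⁻ θ in Theta μ,
    min 1 (∫⁻ t in Set.Ici (0:ℝ),
      ENNReal.ofReal ((1 / ε) * J (dist (χ θ t) x / ε)) * (‖deriv (χ θ) t‖₊ : ℝ≥0∞))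

/-- The alternative mollified irrigation cost `Ẽ^α_ε(χ)`. -/
def Etil {d : ℕ} (μ : Measure (Euc d)) (J : ℝ → ℝ) (α ε : ℝ)
    (χ : ℝ → ℝ → Euc d) : ℝ≥0∞ :=
  ∫⁻ θ in Theta μ, ∫⁻ t in Set.Ici (0:ℝ),
    (Wtil μ J ε χ (χ θ t)) ^ (α - 1) * (‖deriv (χ θ) t‖₊ : ℝ≥0∞)


theorem measurableSet_Theta {d : ℕ} (μ : Measure (Euc d)) : MeasurableSet (Theta μ) :=
  measurableSet_Icc

/-- Two curves starting at the origin and `1`-Lipschitz are, on `[0,k]`, at distance at most `k`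
times their `dPath` distance. -/
theorem dist_le_mul_dPath {d : ℕ} {γ₀ γ₁ : ℝ → Euc d} (h₀ : LipschitzWith 1 γ₀)
    (h₁ : LipschitzWith 1 γ₁) (z₀ : γ₀ 0 = 0) (z₁ : γ₁ 0 = 0) (k : ℕ+) {t : ℝ}
    (ht : t ∈ Set.Icc (0 : ℝ) ((k : ℕ) : ℝ)) :
    dist (γ₀ t) (γ₁ t) ≤ ((k : ℕ) : ℝ) * dPath γ₀ γ₁ := by
  have hk (k : ℕ+) : (0 : ℝ) < ((k : ℕ) : ℝ) := by exact_mod_cast k.pos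
  have bound (k : ℕ+) (s : Set.Icc (0 : ℝ) ((k : ℕ) : ℝ)) :
      dist (γ₀ (s : ℝ)) (γ₁ (s : ℝ)) ≤ 2 * ((k : ℕ) : ℝ) := by
    obtain ⟨s, hs0, hsk⟩ := s
    have e₀ := h₀.dist_le_mul s 0
    have e₁ := h₁.dist_le_mul s 0
    rw [z₀] at e₀
    rw [z₁] at e₁
    have := dist_triangle_right (γ₀ s) (γ₁ s) 0
    simp only [NNReal.coe_one, one_mul, Real.dist_eq, sub_zero, abs_of_nonneg hs0] at e₀ e₁
    linarith
  have inner : dist (γ₀ t) (γ₁ t) ≤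
      ⨆ s : Set.Icc (0 : ℝ) ((k : ℕ) : ℝ), dist (γ₀ (s : ℝ)) (γ₁ (s : ℝ)) :=
    le_ciSup (f := fun s : Set.Icc (0 : ℝ) ((k : ℕ) : ℝ) => dist (γ₀ (s : ℝ)) (γ₁ (s : ℝ)))
      ⟨2 * ((k : ℕ) : ℝ), Set.forall_mem_range.2 (bound k)⟩ ⟨t, ht⟩
  have outer : (1 / ((k : ℕ) : ℝ)) *
      (⨆ s : Set.Icc (0 : ℝ) ((k : ℕ) : ℝ), dist (γ₀ (s : ℝ)) (γ₁ (s : ℝ))) ≤ dPath γ₀ γ₁ := by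
    refine le_ciSup (f := fun k : ℕ+ => (1 / ((k : ℕ) : ℝ)) *
      ⨆ s : Set.Icc (0 : ℝ) ((k : ℕ) : ℝ), dist (γ₀ (s : ℝ)) (γ₁ (s : ℝ)))
      ⟨2, Set.forall_mem_range.2 fun k => ?_⟩ k
    have : Nonempty (Set.Icc (0 : ℝ) ((k : ℕ) : ℝ)) := ⟨⟨0, le_rfl, (hk k).le⟩⟩
    rw [one_div, inv_mul_le_iff₀ (hk k), mul_comm]
    exact ciSup_le (bound k)
  rw [one_div, inv_mul_le_iff₀ (hk k)] at outer
  exact inner.trans outer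

/-- Projection of the real line onto `[0,L]`. -/
def clampTime (L t : ℝ) : ℝ := max 0 (min t L)

theorem continuous_clampTime (L : ℝ) : Continuous (clampTime L) := by
  unfold clampTime; fun_prop

theorem clampTime_mem {L : ℝ} (hL : 0 ≤ L) (t : ℝ) : clampTime L t ∈ Set.Icc 0 L :=
  ⟨le_max_left _ _, max_le hL (min_le_right _ _)⟩

theorem clampTime_eq_min {L t : ℝ} (hL : 0 ≤ L) (ht : 0 ≤ t) : clampTime L t = min t L :=
  max_eq_right (le_min ht hL)

/-- The uniform distance on `[0,L]` between two plans, as a countable supremum. -/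
def unifDist {d : ℕ} (L : ℝ) (χ₀ χ₁ : ℝ → ℝ → Euc d) (θ : ℝ) : ℝ≥0∞ :=
  ⨆ q : ℚ, edist (χ₀ θ (clampTime L q)) (χ₁ θ (clampTime L q))

theorem measurable_unifDist {d : ℕ} (L : ℝ) {χ₀ χ₁ : ℝ → ℝ → Euc d}
    (h₀ : Measurable (Function.uncurry χ₀)) (h₁ : Measurable (Function.uncurry χ₁)) :
    Measurable (unifDist L χ₀ χ₁) :=
  Measurable.iSup fun _ =>
    (h₀.comp measurable_prodMk_right).edist (h₁.comp measurable_prodMk_right)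

theorem edist_le_unifDist {d : ℕ} (L : ℝ) {χ₀ χ₁ : ℝ → ℝ → Euc d} {θ : ℝ}
    (h₀ : Continuous (χ₀ θ)) (h₁ : Continuous (χ₁ θ)) (t : ℝ) :
    edist (χ₀ θ (clampTime L t)) (χ₁ θ (clampTime L t)) ≤ unifDist L χ₀ χ₁ θ := by
  have hc := continuous_clampTime L
  exact Rat.denseRange_cast.induction_on
    (p := fun t : ℝ => edist (χ₀ θ (clampTime L t)) (χ₁ θ (clampTime L t)) ≤ unifDist L χ₀ χ₁ θ) t
    (isClosed_le ((h₀.comp hc).edist (h₁.comp hc)) continuous_const)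
    fun q => le_iSup (fun q : ℚ => edist (χ₀ θ (clampTime L q)) (χ₁ θ (clampTime L q))) q

theorem unifDist_le_dPath {d : ℕ} {χ₀ χ₁ : ℝ → ℝ → Euc d} {θ : ℝ}
    (h₀ : LipschitzWith 1 (χ₀ θ)) (h₁ : LipschitzWith 1 (χ₁ θ))
    (z₀ : χ₀ θ 0 = 0) (z₁ : χ₁ θ 0 = 0) (k : ℕ+) :
    unifDist ((k : ℕ) : ℝ) χ₀ χ₁ θ ≤ ENNReal.ofReal (((k : ℕ) : ℝ) * dPath (χ₀ θ) (χ₁ θ)) :=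
  iSup_le fun q => by
    rw [edist_dist]
    exact ENNReal.ofReal_le_ofReal
      (dist_le_mul_dPath h₀ h₁ z₀ z₁ k (clampTime_mem (Nat.cast_nonneg _) _))

/-- The particles still moving after time `L`. -/
def movingAfter {d : ℕ} (L : ℝ) (χ : ℝ → ℝ → Euc d) : Set ℝ :=
  ⋃ q : ℚ, {θ | χ θ (max (q : ℝ) L) ≠ χ θ L}

theorem measurableSet_movingAfter {d : ℕ} (L : ℝ) {χ : ℝ → ℝ → Euc d}
    (h : Measurable (Function.uncurry χ)) : MeasurableSet (movingAfter L χ) :=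
  MeasurableSet.iUnion fun _ => (measurableSet_eq_fun (h.comp measurable_prodMk_right)
    (h.comp measurable_prodMk_right)).compl

theorem le_stopTime_of_mem_movingAfter {d : ℕ} {L : ℝ} {χ : ℝ → ℝ → Euc d} {θ : ℝ}
    (hconst : ∃ t, 0 < t ∧ ∀ t' ≥ t, χ θ t' = χ θ t) (hθ : θ ∈ movingAfter L χ) :
    L ≤ stopTime χ θ := by
  obtain ⟨q, hq⟩ := Set.mem_iUnion.1 hθ
  refine le_csInf hconst fun t ht => ?_
  by_contra! hlt
  exact hq ((ht.2 _ (hlt.le.trans (le_max_right _ _))).trans (ht.2 L hlt.le).symm)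

theorem eq_clampTime_of_notMem_movingAfter {d : ℕ} {L : ℝ} (hL : 0 ≤ L) {χ : ℝ → ℝ → Euc d}
    {θ : ℝ} (h : Continuous (χ θ)) (hθ : θ ∉ movingAfter L χ) {t : ℝ} (ht : 0 ≤ t) :
    χ θ t = χ θ (clampTime L t) := by
  have key : χ θ (max t L) = χ θ L := by
    refine Rat.denseRange_cast.induction_on (p := fun t : ℝ => χ θ (max t L) = χ θ L) t
      (isClosed_eq (by fun_prop) continuous_const) fun q => ?_
    by_contra hq
    exact hθ (Set.mem_iUnion.2 ⟨q, hq⟩)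
  rw [clampTime_eq_min hL ht]
  rcases le_total t L with h | h
  · rw [min_eq_left h]
  · rwa [min_eq_right h, ← max_eq_left h]

theorem pathInfDist_nonneg {d : ℕ} (χ : ℝ → ℝ → Euc d) (θ : ℝ) (x : Euc d) :
    0 ≤ pathInfDist χ θ x :=
  Real.iInf_nonneg fun _ => dist_nonneg

theorem pathInfDist_le {d : ℕ} (χ : ℝ → ℝ → Euc d) (θ : ℝ) (x : Euc d) {t : ℝ} (ht : 0 ≤ t) :
    pathInfDist χ θ x ≤ dist (χ θ t) x :=
  ciInf_le (f := fun t : Set.Ici (0 : ℝ) => dist (χ θ (t : ℝ)) x)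
    ⟨0, Set.forall_mem_range.2 fun _ => dist_nonneg⟩ ⟨t, ht⟩

/-- If `χ₀ θ` does not move after time `L`, its distance to `y` is bounded below through the
distance of `χ₁ θ` to `x`. -/
theorem pathInfDist_le_add {d : ℕ} {L : ℝ} (hL : 0 ≤ L) {χ₀ χ₁ : ℝ → ℝ → Euc d} {θ : ℝ}
    (h₀ : Continuous (χ₀ θ)) (h₁ : Continuous (χ₁ θ)) (hθ : θ ∉ movingAfter L χ₀)
    (hfin : unifDist L χ₀ χ₁ θ ≠ ∞) (x y : Euc d) :
    pathInfDist χ₁ θ x ≤ pathInfDist χ₀ θ y + ((unifDist L χ₀ χ₁ θ).toReal + dist y x) := by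
  rw [← sub_le_iff_le_add]
  have : Nonempty (Set.Ici (0 : ℝ)) := ⟨⟨0, Set.self_mem_Ici⟩⟩
  refine le_ciInf fun ⟨t, ht⟩ => ?_
  have hd : dist (χ₀ θ (clampTime L t)) (χ₁ θ (clampTime L t)) ≤ (unifDist L χ₀ χ₁ θ).toReal := by
    rw [dist_edist]
    exact ENNReal.toReal_mono hfin (edist_le_unifDist L h₀ h₁ t)
  have hle := pathInfDist_le χ₁ θ x (clampTime_mem hL t).1
  have htri := dist_triangle4 (χ₁ θ (clampTime L t)) (χ₀ θ (clampTime L t)) y x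
  rw [dist_comm (χ₁ θ _) (χ₀ θ _)] at htri
  simp only
  rw [eq_clampTime_of_notMem_movingAfter hL h₀ hθ ht]
  linarith

theorem MollKernel.le_one {J : ℝ → ℝ} (hJ : MollKernel J) {r : ℝ} (hr : 0 ≤ r) : J r ≤ 1 :=
  hJ.2.2.2.1 ▸ hJ.2.1 Set.self_mem_Ici hr hr

theorem MollKernel.le_add {J : ℝ → ℝ} (hJ : MollKernel J) {K : ℝ≥0}
    (hK : LipschitzOnWith K J (Set.Ici 0)) {r s δ : ℝ} (hr : 0 ≤ r) (hs : 0 ≤ s) (hδ : 0 ≤ δ)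
    (h : s ≤ r + δ) : J r ≤ J s + K * δ := by
  rcases le_total s r with hsr | hrs
  · have := hJ.2.1 hs hr hsr
    have : 0 ≤ (K : ℝ) * δ := by positivity
    linarith
  · have h1 := hK.dist_le_mul r hr s hs
    rw [Real.dist_eq, Real.dist_eq, abs_sub_comm r s, abs_of_nonneg (sub_nonneg.2 hrs)] at h1
    have h2 : (K : ℝ) * (s - r) ≤ K * δ := by gcongr; linarith
    linarith [le_abs_self (J r - J s)]

/-- Pointwise comparison of the integrands of the mollified multiplicity. -/
theorem ofReal_mollKernel_le {d : ℕ} {J : ℝ → ℝ} (hJ : MollKernel J) {K : ℝ≥0}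
    (hK : LipschitzOnWith K J (Set.Ici 0)) {ε : ℝ} (hε : 0 < ε) {L : ℝ} (hL : 0 ≤ L)
    {χ₀ χ₁ : ℝ → ℝ → Euc d} {θ : ℝ} (h₀ : Continuous (χ₀ θ)) (h₁ : Continuous (χ₁ θ))
    (x y : Euc d) :
    ENNReal.ofReal (J (pathInfDist χ₀ θ y / ε)) ≤ ENNReal.ofReal (J (pathInfDist χ₁ θ x / ε)) +
      (min 1 (ENNReal.ofReal (K / ε) * (unifDist L χ₀ χ₁ θ + edist y x)) +
        (movingAfter L χ₀).indicator 1 θ) := by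
  have hr : 0 ≤ pathInfDist χ₀ θ y / ε := div_nonneg (pathInfDist_nonneg _ _ _) hε.le
  have hs : 0 ≤ pathInfDist χ₁ θ x / ε := div_nonneg (pathInfDist_nonneg _ _ _) hε.le
  have hone : ENNReal.ofReal (J (pathInfDist χ₀ θ y / ε)) ≤ 1 :=
    ENNReal.ofReal_le_one.2 (hJ.le_one hr)
  by_cases hθ : θ ∈ movingAfter L χ₀
  · rw [Set.indicator_of_mem hθ, Pi.one_apply]
    exact hone.trans (le_add_self.trans le_add_self)
  rw [Set.indicator_of_notMem hθ, add_zero, ← min_add_add_left]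
  refine le_min (hone.trans le_add_self) ?_
  by_cases hfin : unifDist L χ₀ χ₁ θ = ∞
  · rcases eq_or_lt_of_le K.2 with hK0 | hKpos
    · have hle := hJ.le_add hK hr hs (abs_nonneg (pathInfDist χ₁ θ x / ε - pathInfDist χ₀ θ y / ε))
        (by linarith [le_abs_self (pathInfDist χ₁ θ x / ε - pathInfDist χ₀ θ y / ε)])
      rw [show (K : ℝ) = 0 from hK0.symm, zero_mul, add_zero] at hle
      exact (ENNReal.ofReal_le_ofReal hle).trans le_self_add
    · rw [hfin, top_add, ENNReal.mul_top, add_top]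
      · exact le_top
      · exact (ENNReal.ofReal_pos.2 (div_pos hKpos hε)).ne'
  have hδ : 0 ≤ (unifDist L χ₀ χ₁ θ).toReal + dist y x := by positivity
  have hle := hJ.le_add hK hr hs (div_nonneg hδ hε.le) (by
    rw [← add_div]
    gcongr
    exact pathInfDist_le_add hL h₀ h₁ hθ hfin x y)
  rw [← ENNReal.ofReal_toReal hfin, edist_dist,
    ← ENNReal.ofReal_add ENNReal.toReal_nonneg dist_nonneg,
    ← ENNReal.ofReal_mul (by positivity), ← ENNReal.ofReal_add (hJ.1 _ hs) (by positivity)]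
  refine ENNReal.ofReal_le_ofReal (hle.trans_eq ?_)
  ring

/-- Markov's inequality for the stopping time. -/
theorem volume_movingAfter_le {d : ℕ} {μ : Measure (Euc d)} {χ : ℝ → ℝ → Euc d}
    (hχ : IsIrrigPlan μ χ) {C L : ℝ} (hL : 0 < L)
    (hT : ∫⁻ θ in Theta μ, ENNReal.ofReal (stopTime χ θ) ≤ ENNReal.ofReal C) :
    ∫⁻ θ in Theta μ, (movingAfter L χ).indicator 1 θ ≤ ENNReal.ofReal C / ENNReal.ofReal L := by
  have hA := measurableSet_movingAfter L hχ.measurable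
  rw [ENNReal.le_div_iff_mul_le (.inl (ENNReal.ofReal_pos.2 hL).ne') (.inl ENNReal.ofReal_ne_top),
    mul_comm, ← lintegral_const_mul _ (measurable_one.indicator hA)]
  refine (setLIntegral_mono' (measurableSet_Theta μ) fun θ hθ => ?_).trans hT
  by_cases h : θ ∈ movingAfter L χ
  · rw [Set.indicator_of_mem h, Pi.one_apply, mul_one]
    exact ENNReal.ofReal_le_ofReal
      (le_stopTime_of_mem_movingAfter (hχ.eventuallyConst θ hθ) h)
  · simp [Set.indicator_of_notMem h]

theorem tendsto_lintegral_unifDist {d : ℕ} {μ : Measure (Euc d)} {xs : ℕ → Euc d} {x : Euc d}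
    (hx : Tendsto xs atTop (𝓝 x)) {χs : ℕ → ℝ → ℝ → Euc d} {χ : ℝ → ℝ → Euc d}
    (hχs : ∀ n, IsIrrigPlan μ (χs n)) (hχ : IsIrrigPlan μ χ) (hconv : PlansTendsto μ χs χ)
    (a : ℝ) (k : ℕ+) :
    Tendsto (fun n => ∫⁻ θ in Theta μ, min 1 (ENNReal.ofReal a *
      (unifDist ((k : ℕ) : ℝ) (χs n) χ θ + edist (xs n) x))) atTop (𝓝 0) := by
  have hfin : ∫⁻ _ in Theta μ, (1 : ℝ≥0∞) ≠ ∞ := by simp [Theta]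
  have hlim := tendsto_lintegral_of_dominated_convergence (μ := volume.restrict (Theta μ))
    (F := fun n θ => min 1 (ENNReal.ofReal a *
      (unifDist ((k : ℕ) : ℝ) (χs n) χ θ + edist (xs n) x)))
    (f := fun _ => 0) (fun _ => 1)
    (fun n => measurable_const.min (((measurable_unifDist _ (hχs n).measurable
      hχ.measurable).add_const _).const_mul _))
    (fun n => ae_of_all _ fun θ => min_le_left _ _) hfin ?_
  · simpa using hlim
  · filter_upwards [hconv, ae_restrict_mem (measurableSet_Theta μ)] with θ hθ hmem
    have h1 : Tendsto (fun n => unifDist ((k : ℕ) : ℝ) (χs n) χ θ) atTop (𝓝 0) := by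
      have h2 := ENNReal.tendsto_ofReal (hθ.const_mul ((k : ℕ) : ℝ))
      rw [mul_zero, ENNReal.ofReal_zero] at h2
      exact tendsto_of_tendsto_of_tendsto_of_le_of_le tendsto_const_nhds h2
        (fun _ => zero_le) fun n => unifDist_le_dPath ((hχs n).lipschitz θ hmem)
          (hχ.lipschitz θ hmem) ((hχs n).init θ hmem) (hχ.init θ hmem) k
    have h3 := ENNReal.Tendsto.const_mul (a := ENNReal.ofReal a)
      (h1.add (tendsto_iff_edist_tendsto_0.1 hx)) (.inr ENNReal.ofReal_ne_top)
    simpa using (tendsto_const_nhds (x := (1 : ℝ≥0∞))).min h3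

/-- upper semicontinuity of the mollified multiplicity along converging
sequences of points and of irrigation plans with uniformly bounded stopping times. -/
theorem mollified_multiplicity_usc {d : ℕ} (hd : 1 ≤ d)
    (μ : Measure (Euc d)) [IsFiniteMeasure μ]
    (hsupp : ∃ R : ℝ, μ (Metric.closedBall 0 R)ᶜ = 0)
    (J : ℝ → ℝ) (hJ : MollKernel J) (ε : ℝ) (hε : 0 < ε)
    (xs : ℕ → Euc d) (x : Euc d) (hx : Tendsto xs atTop (𝓝 x))
    (χs : ℕ → ℝ → ℝ → Euc d) (χ : ℝ → ℝ → Euc d)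
    (hχs : ∀ n, IsIrrigPlan μ (χs n)) (hχ : IsIrrigPlan μ χ)
    (hconv : PlansTendsto μ χs χ)
    (C : ℝ) (hC : 0 < C)
    (hT : ∀ n, ∫⁻ θ in Theta μ, ENNReal.ofReal (stopTime (χs n) θ) ≤ ENNReal.ofReal C) :
    Filter.limsup (fun n => Wmol μ J ε (χs n) (xs n)) atTop ≤ Wmol μ J ε χ x := by
  obtain ⟨K, hK⟩ := hJ.2.2.1
  have key (k : ℕ+) : limsup (fun n => Wmol μ J ε (χs n) (xs n)) atTop ≤
      Wmol μ J ε χ x + ENNReal.ofReal C / ENNReal.ofReal ((k : ℕ) : ℝ) := by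
    have hk : (0 : ℝ) < ((k : ℕ) : ℝ) := by exact_mod_cast k.pos
    have hbound (n : ℕ) : Wmol μ J ε (χs n) (xs n) ≤ Wmol μ J ε χ x +
        ((∫⁻ θ in Theta μ, min 1 (ENNReal.ofReal (K / ε) *
          (unifDist ((k : ℕ) : ℝ) (χs n) χ θ + edist (xs n) x))) +
          ENNReal.ofReal C / ENNReal.ofReal ((k : ℕ) : ℝ)) := by
      have hg : Measurable fun θ => min 1 (ENNReal.ofReal (K / ε) *
          (unifDist ((k : ℕ) : ℝ) (χs n) χ θ + edist (xs n) x)) :=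
        measurable_const.min (((measurable_unifDist _ (hχs n).measurable
          hχ.measurable).add_const _).const_mul _)
      have hi : Measurable ((movingAfter ((k : ℕ) : ℝ) (χs n)).indicator (1 : ℝ → ℝ≥0∞)) :=
        measurable_one.indicator (measurableSet_movingAfter _ (hχs n).measurable)
      refine (setLIntegral_mono' (measurableSet_Theta μ) fun θ hθ =>
        ofReal_mollKernel_le hJ hK hε hk.le ((hχs n).lipschitz θ hθ).continuous
          (hχ.lipschitz θ hθ).continuous x (xs n)).trans ?_
      refine (lintegral_add_right _ (hg.add hi)).trans_le (add_le_add le_rfl ?_)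
      exact (lintegral_add_right _ hi).trans_le
        (add_le_add le_rfl (volume_movingAfter_le (hχs n) hk (hT n)))
    have hlim := ((tendsto_lintegral_unifDist hx hχs hχ hconv (K / ε) k).add_const
      (ENNReal.ofReal C / ENNReal.ofReal ((k : ℕ) : ℝ))).const_add (Wmol μ J ε χ x)
    rw [zero_add] at hlim
    exact (limsup_le_limsup (.of_forall hbound)).trans_eq hlim.limsup_eq
  have hzero : Tendsto (fun m : ℕ => ENNReal.ofReal C / ENNReal.ofReal ((m + 1 : ℕ) : ℝ))
      atTop (𝓝 0) := by
    simp only [ENNReal.ofReal_natCast]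
    simpa using (tendsto_add_atTop_iff_nat 1).2
      (ENNReal.Tendsto.const_div ENNReal.tendsto_nat_nhds_top (.inr ENNReal.ofReal_ne_top))
  have hlim := hzero.const_add (Wmol μ J ε χ x)
  rw [add_zero] at hlim
  exact ge_of_tendsto' hlim fun m => key m.succPNat

end
end

section
/- Let χ ∈ IP(μ) be an admissible irrigation plan and x ∈ ℝ^d \ {0}. Then the mollified multiplicity converges to the multiplicity as the mollification parameter tends to zero: lim_{ε→0+} W_ε(x,χ) = |x|_χ. -/
open MeasureTheory Filter Topology
open scoped ENNReal NNReal

noncomputable section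

/-- The infimum of a continuous function bounded below is attained along a dense sequence. -/
theorem iInf_denseSeq_eq {X : Type*} [TopologicalSpace X] [TopologicalSpace.SeparableSpace X]
    [Nonempty X] {f : X → ℝ} (hf : Continuous f) (hb : BddBelow (Set.range f)) :
    ⨅ n, f (TopologicalSpace.denseSeq X n) = ⨅ t, f t := by
  have hb' : BddBelow (Set.range fun n => f (TopologicalSpace.denseSeq X n)) :=
    hb.mono (Set.range_comp_subset_range _ f)
  refine le_antisymm (le_ciInf fun t => ?_) (le_ciInf fun n => ciInf_le hb _)
  exact isClosed_property (TopologicalSpace.denseRange_denseSeq X)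
    (isClosed_le continuous_const hf) (fun n => ciInf_le hb' n) t

theorem bddBelow_range_dist {d : ℕ} (γ : ℝ → Euc d) (x : Euc d) :
    BddBelow (Set.range fun t : Set.Ici (0 : ℝ) => dist (γ t) x) :=
  ⟨0, by rintro _ ⟨t, rfl⟩; exact dist_nonneg⟩

/-- A continuous, eventually constant path has distance zero to `x` iff it passes through `x`. -/
theorem pathInfDist_eq_zero_iff {d : ℕ} {χ : ℝ → ℝ → Euc d} {θ : ℝ} (x : Euc d)
    (hc : Continuous (χ θ)) (he : ∃ t, 0 < t ∧ ∀ t' ≥ t, χ θ t' = χ θ t) :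
    pathInfDist χ θ x = 0 ↔ ∃ t, 0 ≤ t ∧ χ θ t = x := by
  constructor
  · intro h
    obtain ⟨T, hT, hconst⟩ := he
    obtain ⟨s, hs, hmin⟩ := (isCompact_Icc (a := (0 : ℝ)) (b := T)).exists_isMinOn
      ⟨0, le_rfl, hT.le⟩ (hc.dist (continuous_const (y := x))).continuousOn
    have hle : dist (χ θ s) x ≤ pathInfDist χ θ x := by
      refine le_ciInf fun t => ?_
      rcases le_total (t : ℝ) T with ht | ht
      · exact hmin ⟨t.2, ht⟩
      · rw [hconst t ht]
        exact hmin ⟨hT.le, le_rfl⟩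
    exact ⟨s, hs.1, dist_le_zero.1 (hle.trans h.le)⟩
  · rintro ⟨t, ht, rfl⟩
    refine le_antisymm ?_ (pathInfDist_nonneg _ _ _)
    exact (ciInf_le (bddBelow_range_dist (χ θ) _) ⟨t, ht⟩).trans_eq (dist_self _)

theorem aemeasurable_pathInfDist {d : ℕ} {μ : Measure (Euc d)} {χ : ℝ → ℝ → Euc d}
    (hχ : IsIrrigPlan μ χ) (x : Euc d) :
    AEMeasurable (fun θ => pathInfDist χ θ x) (volume.restrict (Theta μ)) := by
  refine ⟨fun θ => ⨅ n, dist (χ θ (TopologicalSpace.denseSeq (Set.Ici (0 : ℝ)) n)) x, ?_, ?_⟩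
  · refine Measurable.iInf fun n => Measurable.dist ?_ measurable_const
    exact hχ.measurable.comp (measurable_id.prodMk measurable_const)
  · filter_upwards [ae_restrict_mem measurableSet_Icc] with θ hθ
    exact (iInf_denseSeq_eq (X := Set.Ici (0 : ℝ)) (f := fun t => dist (χ θ t) x)
      (((hχ.lipschitz θ hθ).continuous.comp continuous_subtype_val).dist continuous_const)
      (bddBelow_range_dist _ _)).symm

/-- The rescaled kernel `r ↦ J (r / ε)` converges pointwise on `ℝ₊` to the indicator of `{0}`. -/
theorem MollKernel.tendsto_div {J : ℝ → ℝ} (hJ : MollKernel J) {r : ℝ} (hr : 0 ≤ r) :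
    Tendsto (fun ε : ℝ => ENNReal.ofReal (J (r / ε))) (𝓝[>] (0 : ℝ))
      (𝓝 (({0} : Set ℝ).indicator 1 r)) := by
  obtain ⟨-, -, -, h1, h0⟩ := hJ
  rcases hr.eq_or_lt with rfl | hr
  · simp [h1]
  · rw [Set.indicator_of_notMem (by simpa using hr.ne'), ← ENNReal.ofReal_zero]
    refine ENNReal.tendsto_ofReal (h0.comp ?_)
    exact (tendsto_inv_nhdsGT_zero.const_mul_atTop hr).congr fun ε => (div_eq_mul_inv r ε).symm

/-- the mollified multiplicity converges to the multiplicity as `ε → 0+`. -/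
theorem mollified_mult_tendsto_mult {d : ℕ} (hd : 1 ≤ d)
    (μ : Measure (Euc d)) [IsFiniteMeasure μ]
    (hsupp : ∃ R : ℝ, μ (Metric.closedBall 0 R)ᶜ = 0)
    (J : ℝ → ℝ) (hJ : MollKernel J)
    (χ : ℝ → ℝ → Euc d) (hχ : IsIrrigPlan μ χ) (x : Euc d) (hx : x ≠ 0) :
    Tendsto (fun ε : ℝ => Wmol μ J ε χ x) (𝓝[>] (0:ℝ)) (𝓝 (mult μ χ x)) := by
  have hΘ : MeasurableSet (Theta μ) := measurableSet_Icc
  have hm := aemeasurable_pathInfDist hχ x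
  have hmult : mult μ χ x =
      ∫⁻ θ in Theta μ, ({0} : Set ℝ).indicator 1 (pathInfDist χ θ x) := by
    have hset : {θ ∈ Theta μ | ∃ t, 0 ≤ t ∧ χ θ t = x} =
        (fun θ => pathInfDist χ θ x) ⁻¹' {0} ∩ Theta μ := by
      ext θ
      refine and_comm.trans (and_congr_left fun hθ => ?_)
      exact (pathInfDist_eq_zero_iff x (hχ.lipschitz θ hθ).continuous
        (hχ.eventuallyConst θ hθ)).symm
    rw [mult, hset, ← Measure.restrict_apply' hΘ,
      ← lintegral_indicator_one₀ (hm.nullMeasurable (measurableSet_singleton 0))]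
    rfl
  rw [hmult]
  refine tendsto_lintegral_filter_of_dominated_convergence' (fun _ => 1) ?_ ?_ ?_ ?_
  · refine Eventually.mono self_mem_nhdsWithin fun ε (hε : 0 < ε) => ?_
    have hanti : Antitone fun r => J (max r 0) := fun a b hab =>
      hJ.2.1 (le_max_right a 0) (le_max_right b 0) (max_le_max_right 0 hab)
    have hcomp := (hanti.measurable.comp_aemeasurable (hm.div_const ε)).ennreal_ofReal
    refine hcomp.congr (Eventually.of_forall fun θ => ?_)
    simp [max_eq_left (div_nonneg (pathInfDist_nonneg χ θ x) hε.le)]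
  · refine Eventually.mono self_mem_nhdsWithin fun ε (hε : 0 < ε) => Eventually.of_forall fun θ => ?_
    have hnonneg := div_nonneg (pathInfDist_nonneg χ θ x) hε.le
    exact ENNReal.ofReal_le_one.2
      ((hJ.2.1 Set.self_mem_Ici hnonneg hnonneg).trans_eq hJ.2.2.2.1)
  · simp [Theta]
  · exact Eventually.of_forall fun θ => hJ.tendsto_div (pathInfDist_nonneg χ θ x)

end
end
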